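/- Let X be a Banach space, B ∈ 𝓛(X) a bounded linear operator, and G : X → X an analytic map (everywhere given locally by convergent power series) that is Lipschitz on bounded sets. If u : (0,T) → X is a continuous solution of the ODE u'(t) = B u(t) + G(u(t)), then u is real analytic on (0,T). -/

import Mathlib

open Set Filter Topology

theorem ContinuousMap.update_apply_apply {ι K X : Type*} [DecidableEq ι]
    [TopologicalSpace K] [TopologicalSpace X] (f : ι → C(K, X)) (i : ι) (z : C(K, X)) (k : K) :
    (fun j => Function.update f i z j k) = Function.update (fun j => f j k) i (z k) := by
  ext j
  by_cases hj : j = i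
  · subst hj; simp
  · simp [hj]

section Nemytskii

variable {K X Y : Type*} [TopologicalSpace K] [CompactSpace K]
  [NormedAddCommGroup X] [NormedSpace ℝ X] [NormedAddCommGroup Y] [NormedSpace ℝ Y]

/-- The pointwise action of a continuous multilinear map on continuous functions. -/
noncomputable def ContinuousMultilinearMap.pointwise {n : ℕ}
    (p : ContinuousMultilinearMap ℝ (fun _ : Fin n => X) Y) :
    ContinuousMultilinearMap ℝ (fun _ : Fin n => C(K, X)) C(K, Y) :=
  MultilinearMap.mkContinuous
    { toFun := fun f => ⟨fun k => p fun i => f i k, by fun_prop⟩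
      map_update_add' := fun f i x y => by
        ext k
        simp [ContinuousMap.update_apply_apply]
      map_update_smul' := fun f i c x => by
        ext k
        simp [ContinuousMap.update_apply_apply] }
    ‖p‖ fun f => (ContinuousMap.norm_le _ (by positivity)).2 fun k =>
      (p.le_opNorm _).trans <| by
        gcongr with i
        exact (f i).norm_coe_le_norm k

theorem ContinuousMultilinearMap.norm_pointwise_le {n : ℕ}
    (p : ContinuousMultilinearMap ℝ (fun _ : Fin n => X) Y) :
    ‖(p.pointwise : ContinuousMultilinearMap ℝ (fun _ : Fin n => C(K, X)) C(K, Y))‖ ≤ ‖p‖ :=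
  MultilinearMap.mkContinuous_norm_le _ (norm_nonneg _) _

/-- The superposition operator of a map analytic at `x` is analytic at the constant function `x`. -/
theorem AnalyticAt.continuousMap_comp [CompleteSpace Y] {F : C(X, Y)} {x : X}
    (hF : AnalyticAt ℝ F x) :
    AnalyticAt ℝ (fun w : C(K, X) => F.comp w) (ContinuousMap.const K x) := by
  obtain ⟨p, r, hp⟩ := hF
  let P : FormalMultilinearSeries ℝ C(K, X) C(K, Y) := fun n => (p n).pointwise
  have hr : p.radius ≤ P.radius := by
    refine ENNReal.le_of_forall_nnreal_lt fun s hs => ?_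
    obtain ⟨C, -, hC⟩ := p.norm_mul_pow_le_of_lt_radius hs
    refine P.le_radius_of_bound C fun n => le_trans ?_ (hC n)
    gcongr
    exact (p n).norm_pointwise_le
  refine ⟨P, r, hp.r_le.trans hr, hp.r_pos, fun {w} hw => ?_⟩
  have hsum : HasSum (fun n => P n fun _ => w) (P.sum w) :=
    P.hasSum (Metric.eball_subset_eball (hp.r_le.trans hr) hw)
  have hcomp : F.comp (ContinuousMap.const K x + w) = P.sum w := ContinuousMap.ext fun k => by
    have hk : w k ∈ Metric.eball (0 : X) r := by
      rw [mem_eball_zero_iff] at hw ⊢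
      exact (enorm_le_iff_norm_le.2 (w.norm_coe_le_norm k)).trans_lt hw
    exact (hp.hasSum hk).unique (hsum.mapL (ContinuousMap.evalCLM ℝ k))
  exact hcomp ▸ hsum

end Nemytskii

section

variable {X : Type*} [NormedAddCommGroup X] [NormedSpace ℝ X]

/-- The primitive vanishing at `0`, as an operator on continuous functions on `[0, 1]`. -/
noncomputable def ContinuousMap.volterra : C(Icc (0 : ℝ) 1, X) →L[ℝ] C(Icc (0 : ℝ) 1, X) :=
  LinearMap.mkContinuous
    { toFun := fun w => ⟨fun s => ∫ r in (0 : ℝ)..s, w (projIcc 0 1 zero_le_one r), by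
        have hw : Continuous fun r => w (projIcc (0 : ℝ) 1 zero_le_one r) :=
          w.continuous.comp continuous_projIcc
        exact (intervalIntegral.continuous_primitive
          (fun a b => hw.intervalIntegrable a b) 0).comp continuous_subtype_val⟩
      map_add' := fun v w => by
        ext s
        exact intervalIntegral.integral_add
          ((v.continuous.comp continuous_projIcc).intervalIntegrable _ _)
          ((w.continuous.comp continuous_projIcc).intervalIntegrable _ _)
      map_smul' := fun c w => by
        ext s
        exact intervalIntegral.integral_smul c _ }
    1 fun w => (ContinuousMap.norm_le _ (by positivity)).2 fun s => by
      refine (intervalIntegral.norm_integral_le_of_norm_le_const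
        fun r _ => w.norm_coe_le_norm _).trans ?_
      rw [sub_zero, abs_of_nonneg s.2.1, one_mul]
      exact mul_le_of_le_one_right (norm_nonneg _) s.2.2

theorem ContinuousMap.volterra_apply (w : C(Icc (0 : ℝ) 1, X)) (s : Icc (0 : ℝ) 1) :
    volterra w s = ∫ r in (0 : ℝ)..s, w (projIcc 0 1 zero_le_one r) := rfl

/-- The shear `(ε, w) ↦ (ε, w - ε • v)`. -/
noncomputable def shearEquiv (v : X) : (ℝ × X) ≃L[ℝ] (ℝ × X) :=
  ContinuousLinearEquiv.equivOfInverse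
    ((ContinuousLinearMap.fst ℝ ℝ X).prod
      (ContinuousLinearMap.snd ℝ ℝ X - (ContinuousLinearMap.fst ℝ ℝ X).smulRight v))
    ((ContinuousLinearMap.fst ℝ ℝ X).prod
      (ContinuousLinearMap.snd ℝ ℝ X + (ContinuousLinearMap.fst ℝ ℝ X).smulRight v))
    (fun p => by ext <;> simp) (fun p => by ext <;> simp)

/-- A continuous curve solving `w = w₀ + ε • A w`, with `A` analytic, is analytic at `ε = 0`. -/
theorem analyticAt_of_eventually_eq_add_smul [CompleteSpace X] {A : X → X} {w : ℝ → X}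
    (hA : AnalyticAt ℝ A (w 0)) (hw : ContinuousAt w 0)
    (h : ∀ᶠ ε in 𝓝 (0 : ℝ), w ε = w 0 + ε • A (w ε)) : AnalyticAt ℝ w 0 := by
  let Φ : ℝ × X → ℝ × X := fun p => (p.1, p.2 - p.1 • A p.2)
  have hA' : AnalyticAt ℝ (fun p : ℝ × X => A p.2) (0, w 0) :=
    AnalyticAt.fun_comp (f := fun p : ℝ × X => p.2) hA analyticAt_snd
  have hΦ : AnalyticAt ℝ Φ (0, w 0) :=
    analyticAt_fst.prod (analyticAt_snd.sub (analyticAt_fst.smul hA'))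
  have hd : HasFDerivAt Φ (shearEquiv (A (w 0)) : ℝ × X →L[ℝ] ℝ × X) (0, w 0) := by
    have h2 := hasFDerivAt_fst.prodMk (hasFDerivAt_snd.sub
      (hasFDerivAt_fst.smul hA'.differentiableAt.hasFDerivAt) :
        HasFDerivAt (fun p : ℝ × X => p.2 - p.1 • A p.2) _ (0, w 0))
    refine h2.congr_fderiv ?_
    ext <;> simp [shearEquiv]
  have hs : HasStrictFDerivAt Φ (shearEquiv (A (w 0)) : ℝ × X →L[ℝ] ℝ × X) (0, w 0) :=
    hd.fderiv ▸ hΦ.hasStrictFDerivAt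
  have hinv : AnalyticAt ℝ (hs.localInverse Φ _ _) (Φ (0, w 0)) :=
    OpenPartialHomeomorph.analyticAt_symm' (hs.toOpenPartialHomeomorph Φ)
      hs.mem_toOpenPartialHomeomorph_source hΦ hd.fderiv
  have h0 : Φ (0, w 0) = (0, w 0) := by simp [Φ]
  rw [h0] at hinv
  have hcomp : AnalyticAt ℝ (fun ε : ℝ => (hs.localInverse Φ _ _ (ε, w 0)).2) 0 :=
    analyticAt_snd.comp
      (AnalyticAt.fun_comp (f := fun ε : ℝ => (ε, w 0)) hinv (analyticAt_id.prod analyticAt_const))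
  refine hcomp.congr ?_
  have ht : Tendsto (fun ε : ℝ => (ε, w ε)) (𝓝 0) (𝓝 (0, w 0)) :=
    (continuousAt_id.prodMk hw).tendsto
  filter_upwards [h, ht.eventually hs.eventually_left_inverse] with ε hε hl
  have hΦε : Φ (ε, w ε) = (ε, w 0) := by
    simp only [Φ, Prod.mk.injEq, true_and]
    exact sub_eq_iff_eq_add.2 hε
  rw [← hΦε, hl]

/-- Continuous solutions of an autonomous ODE with analytic vector field are analytic. -/
theorem AnalyticAt.of_hasDerivAt_comp [CompleteSpace X] {F : C(X, X)} {u : C(ℝ, X)} {t : ℝ}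
    (hF : AnalyticAt ℝ F (u t)) (hu : ∀ᶠ s in 𝓝 t, HasDerivAt u (F (u s)) s) :
    AnalyticAt ℝ u t := by
  let w : C(ℝ, C(Icc (0 : ℝ) 1, X)) :=
    ContinuousMap.curry ⟨fun p : ℝ × Icc (0 : ℝ) 1 => u (t + p.1 * p.2), by fun_prop⟩
  have hw (ε : ℝ) (s : Icc (0 : ℝ) 1) : w ε s = u (t + ε * s) := rfl
  have hw0 : w 0 = ContinuousMap.const _ (u t) := by ext s; simp [hw]
  let A : C(Icc (0 : ℝ) 1, X) → C(Icc (0 : ℝ) 1, X) := fun v => ContinuousMap.volterra (F.comp v)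
  have hA : AnalyticAt ℝ A (w 0) := by
    rw [hw0]
    exact (ContinuousMap.volterra.analyticAt _).comp hF.continuousMap_comp
  have hwa : AnalyticAt ℝ w 0 := by
    refine analyticAt_of_eventually_eq_add_smul hA w.continuous.continuousAt ?_
    obtain ⟨δ, hδ, hball⟩ := Metric.eventually_nhds_iff.1 hu
    filter_upwards [Metric.ball_mem_nhds (0 : ℝ) hδ] with ε hε
    rw [Metric.mem_ball, dist_zero_right, Real.norm_eq_abs] at hε
    ext s
    have hint : ∫ r in (0 : ℝ)..s, ε • F (u (t + ε * r)) = u (t + ε * s) - u (t + ε * 0) := by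
      refine intervalIntegral.integral_eq_sub_of_hasDerivAt (f := fun r => u (t + ε * r))
        (fun r hr => ?_) (Continuous.intervalIntegrable (by fun_prop) _ _)
      rw [uIcc_of_le s.2.1] at hr
      have hmem : dist (t + ε * r) t < δ := by
        rw [Real.dist_eq, add_sub_cancel_left, abs_mul, abs_of_nonneg hr.1]
        exact (mul_le_of_le_one_right (abs_nonneg ε) (hr.2.trans s.2.2)).trans_lt hε
      have haff : HasDerivAt (fun r : ℝ => t + ε * r) ε r := by
        simpa using ((hasDerivAt_id r).const_mul ε).const_add t
      exact (hball hmem).scomp r haff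
    have hcongr : ∫ r in (0 : ℝ)..s, F (w ε (projIcc 0 1 zero_le_one r))
        = ∫ r in (0 : ℝ)..s, F (u (t + ε * r)) := by
      refine intervalIntegral.integral_congr fun r hr => ?_
      rw [uIcc_of_le s.2.1] at hr
      simp only [hw, projIcc_of_mem zero_le_one ⟨hr.1, hr.2.trans s.2.2⟩]
    have hAs : A (w ε) s = ∫ r in (0 : ℝ)..s, F (u (t + ε * r)) := hcongr
    rw [intervalIntegral.integral_smul] at hint
    simp [hAs, hint, hw]
  have h1 : AnalyticAt ℝ (fun ε => w ε 1) 0 :=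
    ((ContinuousMap.evalCLM (M := X) ℝ (1 : Icc (0 : ℝ) 1)).analyticAt _).fun_comp hwa
  have h2 : AnalyticAt ℝ (fun s => w (s - t) 1) t :=
    AnalyticAt.fun_comp_of_eq (g := fun ε => w ε 1) h1 (analyticAt_id.sub analyticAt_const) (sub_self t)
  refine h2.congr (Eventually.of_forall fun s => ?_)
  simp [hw]

end



/-- Let `X` be a Banach space, `B` a bounded linear operator on `X`,
and `G : X → X` an analytic map which is Lipschitz on bounded sets. If `u : (0,T) → X`
is a continuous solution of the ODE `u' = B u + G(u)`, then `u` is real analytic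
on `(0,T)`. -/
theorem ode_analytic_nonlinearity_implies_analytic_solution
    {X : Type*} [NormedAddCommGroup X] [NormedSpace ℝ X] [CompleteSpace X]
    (B : X →L[ℝ] X) (G : X → X)
    (hGanal : ∀ x : X, AnalyticAt ℝ G x)
    (hGlip : ∀ R : ℝ, ∃ L : NNReal, LipschitzOnWith L G (Metric.ball (0 : X) R))
    (T : ℝ) (hT : 0 < T) (u : ℝ → X)
    (hu_cont : ContinuousOn u (Ioo 0 T))
    (hu_ode : ∀ t ∈ Ioo (0 : ℝ) T, HasDerivAt u (B (u t) + G (u t)) t) :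
    ∀ t ∈ Ioo (0 : ℝ) T, AnalyticAt ℝ u t := by
  intro t ht
  obtain ⟨δ, hδ, hball⟩ := Metric.nhds_basis_closedBall.mem_iff.1 (Ioo_mem_nhds ht.1 ht.2)
  rw [Real.closedBall_eq_Icc] at hball
  have hle : t - δ ≤ t + δ := by linarith
  let v : C(ℝ, X) := ⟨IccExtend hle ((Icc (t - δ) (t + δ)).domRestrict u),
    ((hu_cont.mono hball).domRestrict).Icc_extend'⟩
  have hvu : ∀ s ∈ Icc (t - δ) (t + δ), v s = u s := fun s hs =>
    IccExtend_of_mem hle ((Icc (t - δ) (t + δ)).domRestrict u) hs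
  have hmem : ∀ᶠ s in 𝓝 t, s ∈ Icc (t - δ) (t + δ) :=
    Icc_mem_nhds (by linarith) (by linarith)
  have hFanal : ∀ x, AnalyticAt ℝ (fun x => B x + G x) x :=
    fun x => (B.analyticAt x).add (hGanal x)
  let F : C(X, X) := ⟨fun x => B x + G x,
    continuous_iff_continuousAt.2 fun x => (hFanal x).continuousAt⟩
  have hv : AnalyticAt ℝ v t := by
    refine AnalyticAt.of_hasDerivAt_comp (F := F) (hFanal _) ?_
    filter_upwards [hmem.eventually_nhds, hmem] with s hs hs'
    rw [hvu s hs']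
    exact (hu_ode s (hball hs')).congr_of_eventuallyEq (hs.mono hvu)
  exact hv.congr (hmem.mono hvu)
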